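/- Let Ã be an invertible n×n real matrix, L an n×k real matrix whose Gram matrix LᵀL is invertible, and R a k×n real matrix, and assume Â = Ã + L·R is invertible. Then the Woodbury operator W = I_k + R·Ã⁻¹·L is invertible and its condition number satisfies κ(W) ≤ (‖L†‖·‖L‖)²·κ(Â)·κ(Ã), where L† = (LᵀL)⁻¹Lᵀ. -/

import Mathlib

open Matrix

/-- The spectral norm of a real matrix: the operator norm of the induced linear map
between Euclidean spaces. -/
noncomputable def specNorm {m n : ℕ} (M : Matrix (Fin m) (Fin n) ℝ) : ℝ :=
  ‖LinearMap.toContinuousLinearMap (Matrix.toEuclideanLin M)‖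

open scoped Matrix.Norms.L2Operator in
lemma specNorm_mul_le {m n l : ℕ} (A : Matrix (Fin m) (Fin n) ℝ) (B : Matrix (Fin n) (Fin l) ℝ) :
    specNorm (A * B) ≤ specNorm A * specNorm B :=
  l2_opNorm_mul A B

lemma specNorm_nonneg {m n : ℕ} (A : Matrix (Fin m) (Fin n) ℝ) : 0 ≤ specNorm A :=
  norm_nonneg _

lemma specNorm_mul_mul_mul_le {m n l p q : ℕ} (A : Matrix (Fin m) (Fin n) ℝ)
    (B : Matrix (Fin n) (Fin l) ℝ) (C : Matrix (Fin l) (Fin p) ℝ) (D : Matrix (Fin p) (Fin q) ℝ) :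
    specNorm (A * B * C * D) ≤ specNorm A * specNorm B * specNorm C * specNorm D := by
  have hC := specNorm_nonneg C
  have hD := specNorm_nonneg D
  calc specNorm (A * B * C * D) ≤ specNorm (A * B * C) * specNorm D := specNorm_mul_le _ _
    _ ≤ specNorm (A * B) * specNorm C * specNorm D := by gcongr; exact specNorm_mul_le _ _
    _ ≤ specNorm A * specNorm B * specNorm C * specNorm D := by gcongr; exact specNorm_mul_le _ _

/-- the Woodbury operator is invertible and its condition number
satisfies `κ(W) ≤ (‖L†‖·‖L‖)²·κ(Â)·κ(Ã)`. -/
theorem woodbury_condition_left {n k : ℕ}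
    (Atil : Matrix (Fin n) (Fin n) ℝ)
    (L : Matrix (Fin n) (Fin k) ℝ) (R : Matrix (Fin k) (Fin n) ℝ)
    (hA : IsUnit Atil.det) (hG : IsUnit (Lᵀ * L).det)
    (hAhat : IsUnit (Atil + L * R).det) :
    IsUnit (1 + R * Atil⁻¹ * L).det ∧
    specNorm (1 + R * Atil⁻¹ * L) * specNorm (1 + R * Atil⁻¹ * L)⁻¹ ≤
      (specNorm ((Lᵀ * L)⁻¹ * Lᵀ) * specNorm L) ^ 2 *
        (specNorm (Atil + L * R) * specNorm (Atil + L * R)⁻¹) *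
        (specNorm Atil * specNorm Atil⁻¹) := by
  set Ahat := Atil + L * R with hAhat_def
  set W := 1 + R * Atil⁻¹ * L with hW_def
  set P := (Lᵀ * L)⁻¹ * Lᵀ with hP_def
  have hPL : P * L = 1 := by
    rw [hP_def, Matrix.mul_assoc, nonsing_inv_mul _ hG]
  have hLW : L * W = Ahat * Atil⁻¹ * L := by
    rw [hW_def, hAhat_def, Matrix.add_mul, mul_nonsing_inv _ hA]
    simp only [Matrix.mul_add, Matrix.add_mul, Matrix.mul_one, Matrix.one_mul, Matrix.mul_assoc]
  have hW : W = P * Ahat * Atil⁻¹ * L := by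
    calc W = P * L * W := by rw [hPL, Matrix.one_mul]
      _ = P * Ahat * Atil⁻¹ * L := by rw [Matrix.mul_assoc, hLW]; simp only [Matrix.mul_assoc]
  have hinv : P * Atil * Ahat⁻¹ * L * W = 1 := by
    calc P * Atil * Ahat⁻¹ * L * W = P * Atil * Ahat⁻¹ * (Ahat * Atil⁻¹ * L) := by
          rw [Matrix.mul_assoc _ L W, hLW]
      _ = P * (Atil * ((Ahat⁻¹ * Ahat) * (Atil⁻¹ * L))) := by simp only [Matrix.mul_assoc]
      _ = P * ((Atil * Atil⁻¹) * L) := by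
          rw [nonsing_inv_mul _ hAhat, Matrix.one_mul, Matrix.mul_assoc Atil]
      _ = 1 := by rw [mul_nonsing_inv _ hA, Matrix.one_mul, hPL]
  refine ⟨isUnit_det_of_left_inverse hinv, ?_⟩
  have hWn : specNorm W ≤ specNorm P * specNorm Ahat * specNorm Atil⁻¹ * specNorm L :=
    (congrArg specNorm hW).trans_le (specNorm_mul_mul_mul_le _ _ _ _)
  have hWi : specNorm W⁻¹ ≤ specNorm P * specNorm Atil * specNorm Ahat⁻¹ * specNorm L := by
    rw [inv_eq_left_inv hinv]
    exact specNorm_mul_mul_mul_le _ _ _ _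
  calc specNorm W * specNorm W⁻¹
      ≤ (specNorm P * specNorm Ahat * specNorm Atil⁻¹ * specNorm L) *
        (specNorm P * specNorm Atil * specNorm Ahat⁻¹ * specNorm L) :=
        mul_le_mul hWn hWi (specNorm_nonneg _) ((specNorm_nonneg _).trans hWn)
    _ = _ := by ring
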